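/- Let d ≥ 1 and let Λ ⊂ Z^d be finite. There is a bijection σ_Λ from the set 𝒜_Λ of allowed configurations ξ ∈ {0,1,…,2d}^Λ onto the set 𝒯_Λ of spanning trees of the multigraph G_Λ such that for every ξ ∈ 𝒜_Λ the set of dissipative edges contained in σ_Λ(ξ) is exactly {diss(x) : x ∈ Λ, ξ_x = 2d}. In particular, σ_Λ restricts to a bijection between the allowed configurations in {0,1,…,2d−1}^Λ and the spanning trees of G_Λ containing no dissipative edge. -/

import Mathlib

/- STATEMENT 1: The Majumdar–Dhar bijection between allowed configurations and
spanning trees of the multigraph `G_Λ`, mapping configurations with `ξ x = 2d`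
exactly to trees containing the dissipative edge at `x`. -/

namespace Sandpile1

/-- The lattice `ℤ^d`. -/
abbrev Zd (d : ℕ) := Fin d → ℤ

/-- Nearest-neighbour adjacency in `ℤ^d`. -/
def adj {d : ℕ} (x y : Zd d) : Prop := (∑ i, (x i - y i).natAbs) = 1

instance {d : ℕ} (x y : Zd d) : Decidable (adj x y) := by unfold adj; infer_instance

/-- Forbidden subconfiguration. -/
def IsFSC {d : ℕ} (ξ : Zd d → ℕ) (W : Finset (Zd d)) : Prop :=
  ∀ y ∈ W, ξ y < (W.filter (fun z => adj z y)).card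

/-- Allowed configuration on `Λ`. -/
def Allowed {d : ℕ} (Λ : Finset (Zd d)) (ξ : Zd d → ℕ) : Prop :=
  ∀ W ⊆ Λ, W.Nonempty → ¬ IsFSC ξ W

/-- Vertices of the wired multigraph `G_Λ`: lattice points together with the
extra vertex `ϖ = Sum.inr ()`. -/
abbrev V (d : ℕ) := Zd d ⊕ Unit

/-- Edges of the multigraph `G_Λ`: ordinary edges (recorded by their `ℤ^d`
endpoints, so that parallel edges between `x ∈ Λ` and `ϖ` coming from different
outside neighbours are distinguished) and dissipative edges `diss x`. -/
inductive EdgeG (d : ℕ) where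
  | ord : Sym2 (Zd d) → EdgeG d
  | diss : Zd d → EdgeG d
deriving DecidableEq

/-- Projection to the vertex set of `G_Λ`: points outside `Λ` are identified with `ϖ`. -/
def proj {d : ℕ} (Λ : Finset (Zd d)) (z : Zd d) : V d :=
  if z ∈ Λ then Sum.inl z else Sum.inr ()

/-- The edges of `G_Λ`: ordinary edges between `ℤ^d`-adjacent points, at least one of
which lies in `Λ` (so no loops at `ϖ`), and a dissipative edge for each `x ∈ Λ`. -/
def validEdge {d : ℕ} (Λ : Finset (Zd d)) : EdgeG d → Prop
  | .ord e => ∃ x y, e = s(x, y) ∧ adj x y ∧ (x ∈ Λ ∨ y ∈ Λ)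
  | .diss x => x ∈ Λ

/-- `joins Λ e u v`: the edge `e` has endpoints `u` and `v` in `G_Λ`. -/
def joins {d : ℕ} (Λ : Finset (Zd d)) : EdgeG d → V d → V d → Prop
  | .ord e, u, v => ∃ x y, e = s(x, y) ∧
      ((u = proj Λ x ∧ v = proj Λ y) ∨ (u = proj Λ y ∧ v = proj Λ x))
  | .diss x, u, v => (u = Sum.inl x ∧ v = Sum.inr ()) ∨ (u = Sum.inr () ∧ v = Sum.inl x)

/-- Connectivity of two vertices using only edges in `t`. -/
def connIn {d : ℕ} (Λ : Finset (Zd d)) (t : Set (EdgeG d)) (u v : V d) : Prop :=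
  Relation.ReflTransGen (fun a b => ∃ e ∈ t, joins Λ e a b) u v

/-- `t` is a spanning tree of `G_Λ`: a set of edges of `G_Λ`, connecting every vertex
(to `ϖ`), and containing no cycle (no edge of `t` has its endpoints joined within
`t` minus that edge; in particular there are no loops and no parallel edges). -/
def IsSpanningTree {d : ℕ} (Λ : Finset (Zd d)) (t : Finset (EdgeG d)) : Prop :=
  (∀ e ∈ t, validEdge Λ e) ∧
  (∀ x ∈ Λ, connIn Λ ↑t (Sum.inl x) (Sum.inr ())) ∧
  (∀ e ∈ t, ∀ u v, joins Λ e u v → ¬ connIn Λ ((↑t : Set (EdgeG d)) \ {e}) u v)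

/-- Allowed configurations `ξ ∈ {0,…,2d}^Λ` (extended by `0` outside `Λ`). -/
def AllowedCfg (d : ℕ) (Λ : Finset (Zd d)) :=
  {ξ : Zd d → ℕ // (∀ x ∈ Λ, ξ x ≤ 2*d) ∧ (∀ x ∉ Λ, ξ x = 0) ∧ Allowed Λ ξ}

/-- Spanning trees of `G_Λ`. -/
def SpTree (d : ℕ) (Λ : Finset (Zd d)) := {t : Finset (EdgeG d) // IsSpanningTree Λ t}

lemma adj_comm {d : ℕ} {x y : Zd d} : adj x y ↔ adj y x := by
  simp only [adj]
  rw [Finset.sum_congr rfl fun i _ => by rw [← Int.natAbs_neg, neg_sub]]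

/-- The nearest neighbours of `x` in `ℤ^d`. -/
def nbr {d : ℕ} (x : Zd d) : Finset (Zd d) :=
  Finset.univ.image fun q : Fin d × Bool => x + Pi.single q.1 (if q.2 then 1 else -1)

lemma mem_nbr {d : ℕ} {x z : Zd d} : z ∈ nbr x ↔ adj z x := by
  simp only [nbr, Finset.mem_image, Finset.mem_univ, true_and, adj]
  constructor
  · rintro ⟨⟨i, b⟩, rfl⟩
    rw [Finset.sum_eq_single i]
    · cases b <;> simp
    · intro j _ hj
      simp [hj]
    · simp
  · intro h
    obtain ⟨i, -, hi⟩ : ∃ i ∈ Finset.univ, (z i - x i).natAbs ≠ 0 :=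
      Finset.exists_ne_zero_of_sum_ne_zero (by rw [h]; exact one_ne_zero)
    rw [← Finset.add_sum_erase _ _ (Finset.mem_univ i)] at h
    have hrest : ∑ j ∈ Finset.univ.erase i, (z j - x j).natAbs = 0 := by omega
    rw [Finset.sum_eq_zero_iff] at hrest
    refine ⟨(i, decide (z i - x i = 1)), funext fun j => ?_⟩
    by_cases hj : j = i
    · subst hj
      simp only [Pi.add_apply, Pi.single_eq_same, decide_eq_true_eq]
      split_ifs <;> omega
    · have := hrest j (by simp [hj])
      simp only [Pi.add_apply, Pi.single_eq_of_ne hj]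
      omega

lemma card_nbr {d : ℕ} (x : Zd d) : (nbr x).card = 2 * d := by
  rw [nbr, Finset.card_image_of_injective]
  · simp [mul_comm]
  · rintro ⟨i, b⟩ ⟨j, c⟩ h
    have h' := congrFun (add_left_cancel h) i
    simp only [Pi.single_eq_same] at h'
    by_cases hij : i = j
    · subst hij
      cases b <;> cases c <;> simp at h' ⊢
    · rw [Pi.single_eq_of_ne hij] at h'
      cases b <;> simp at h'

lemma exists_rank {α : Type*} (S : Finset α) :
    ∃ r : α → ℕ, Set.InjOn r S ∧ (∀ w ∈ S, r w < S.card) ∧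
      ∀ k < S.card, ∃ w ∈ S, r w = k := by
  classical
  refine ⟨fun w => if h : w ∈ S then (S.equivFin ⟨w, h⟩ : ℕ) else 0, ?_, ?_, ?_⟩
  · intro a ha b hb h
    simp only [Finset.mem_coe] at ha hb
    simp only [ha, hb, dif_pos] at h
    simpa using S.equivFin.injective (Fin.ext h)
  · intro w hw
    simp only [hw, dif_pos]
    exact (S.equivFin ⟨w, hw⟩).2
  · intro k hk
    refine ⟨S.equivFin.symm ⟨k, hk⟩, (S.equivFin.symm ⟨k, hk⟩).2, ?_⟩
    simp

/-- A numbering of the elements of `S` by `0, …, S.card - 1`. -/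
noncomputable def rank {α : Type*} (S : Finset α) : α → ℕ := (exists_rank S).choose

lemma rank_injOn {α : Type*} (S : Finset α) : Set.InjOn (rank S) S :=
  (exists_rank S).choose_spec.1

lemma rank_lt {α : Type*} {S : Finset α} {w : α} (h : w ∈ S) : rank S w < S.card :=
  (exists_rank S).choose_spec.2.1 w h

lemma exists_rank_eq {α : Type*} {S : Finset α} {k : ℕ} (h : k < S.card) :
    ∃ w ∈ S, rank S w = k :=
  (exists_rank S).choose_spec.2.2 k h

variable {d : ℕ} {Λ : Finset (Zd d)} {l l' : Zd d → ℕ} {p p' : Zd d → Option (Zd d)}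

/-- `p` assigns a parent to each site of `Λ` (`none` standing for the dissipative edge), and
`l` is the resulting distance to the root, the sites outside `Λ` being identified with it. -/
def IsLeveled (Λ : Finset (Zd d)) (l : Zd d → ℕ) (p : Zd d → Option (Zd d)) : Prop :=
  (∀ x ∉ Λ, l x = 0 ∧ p x = none) ∧
  ∀ x ∈ Λ, (p x = none ∧ l x = 1) ∨ ∃ w, p x = some w ∧ adj w x ∧ l x = l w + 1

lemma IsLeveled.pos (h : IsLeveled Λ l p) {x : Zd d} (hx : x ∈ Λ) : 0 < l x := by
  rcases h.2 x hx with h | ⟨w, h⟩ <;> omega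

lemma IsLeveled.mem_of_pos (h : IsLeveled Λ l p) {x : Zd d} (hx : 0 < l x) : x ∈ Λ := by
  by_contra hx'
  have := (h.1 x hx').1
  omega

/-- The number of neighbours of `x` at the level of `x` or above. -/
def lo (l : Zd d → ℕ) (x : Zd d) : ℕ := ((nbr x).filter fun z => l x ≤ l z).card

/-- The neighbours of `x` one level below `x`. -/
def below (l : Zd d → ℕ) (x : Zd d) : Finset (Zd d) := (nbr x).filter fun z => l x = l z + 1

lemma mem_below {x z : Zd d} : z ∈ below l x ↔ adj z x ∧ l x = l z + 1 := by
  simp [below, mem_nbr]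

lemma lo_add_card_below (l : Zd d → ℕ) (x : Zd d) :
    lo l x + (below l x).card = ((nbr x).filter fun z => l x ≤ l z + 1).card := by
  rw [lo, below, ← Finset.card_union_of_disjoint, ← Finset.filter_or]
  · congr 1
    refine Finset.filter_congr fun z _ => ?_
    omega
  · rw [Finset.disjoint_filter]
    intro z _ h
    omega

lemma lo_add_card_below_le (l : Zd d → ℕ) (x : Zd d) : lo l x + (below l x).card ≤ 2 * d := by
  rw [lo_add_card_below, ← card_nbr x]
  exact Finset.card_filter_le _ _

/-- The height at `x` encoding the parent `c` of `x`. -/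
noncomputable def code (l : Zd d → ℕ) (x : Zd d) : Option (Zd d) → ℕ
  | none => 2 * d
  | some w => lo l x + rank (below l x) w

/-- The configuration encoding a parent function. -/
noncomputable def toCfg (Λ : Finset (Zd d)) (l : Zd d → ℕ) (p : Zd d → Option (Zd d))
    (x : Zd d) : ℕ :=
  if x ∈ Λ then code l x (p x) else 0

lemma IsLeveled.code_cases (h : IsLeveled Λ l p) {x : Zd d} (hx : x ∈ Λ) :
    (p x = none ∧ l x = 1 ∧ toCfg Λ l p x = 2 * d) ∨
      ∃ w ∈ below l x, p x = some w ∧ toCfg Λ l p x = lo l x + rank (below l x) w := by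
  rcases h.2 x hx with ⟨hp, hl⟩ | ⟨w, hp, ha, hl⟩
  · left
    simp [toCfg, hx, hp, hl, code]
  · right
    exact ⟨w, mem_below.2 ⟨ha, hl⟩, hp, by simp [toCfg, hx, hp, code]⟩

lemma IsLeveled.lo_le (h : IsLeveled Λ l p) {x : Zd d} (hx : x ∈ Λ) :
    lo l x ≤ toCfg Λ l p x := by
  have := lo_add_card_below_le l x
  rcases h.code_cases hx with ⟨-, -, hc⟩ | ⟨w, hw, -, hc⟩ <;> omega

lemma IsLeveled.toCfg_lt (h : IsLeveled Λ l p) {x : Zd d} (hx : x ∈ Λ) (hp : p x ≠ none) :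
    toCfg Λ l p x < lo l x + (below l x).card := by
  rcases h.code_cases hx with ⟨hc, -⟩ | ⟨w, hw, -, hc⟩
  · exact absurd hc hp
  · have := rank_lt hw
    omega

lemma IsLeveled.toCfg_le (h : IsLeveled Λ l p) {x : Zd d} (hx : x ∈ Λ) :
    toCfg Λ l p x ≤ 2 * d := by
  have := lo_add_card_below_le l x
  rcases h.code_cases hx with ⟨-, -, hc⟩ | ⟨w, hw, -, hc⟩
  · omega
  · have := rank_lt hw
    omega

lemma IsLeveled.toCfg_eq_iff (h : IsLeveled Λ l p) {x : Zd d} (hx : x ∈ Λ) :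
    toCfg Λ l p x = 2 * d ↔ p x = none := by
  constructor
  · intro he
    by_contra hp
    have := h.toCfg_lt hx hp
    have := lo_add_card_below_le l x
    omega
  · intro hp
    simp [toCfg, hx, hp, code]

lemma IsLeveled.allowed (h : IsLeveled Λ l p) : Allowed Λ (toCfg Λ l p) := by
  intro W hW hne hF
  obtain ⟨y, hy, hmin⟩ := Finset.exists_min_image W l hne
  have hlt := hF y hy
  have hle : (W.filter fun z => adj z y).card ≤ lo l y := by
    refine Finset.card_le_card fun z hz => ?_
    rw [Finset.mem_filter] at hz ⊢
    exact ⟨mem_nbr.2 hz.2, hmin z hz.1⟩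
  have := h.lo_le (hW hy)
  omega

lemma IsLeveled.level_le_of_toCfg_eq (h : IsLeveled Λ l p) (h' : IsLeveled Λ l' p')
    (he : toCfg Λ l p = toCfg Λ l' p') {n : ℕ} (hn : ∀ z, l z ≤ n ↔ l' z ≤ n)
    {x : Zd d} (hx : l x ≤ n + 1) : l' x ≤ n + 1 := by
  by_cases hxn : l x ≤ n
  · exact ((hn x).1 hxn).trans n.le_succ
  have hxl : l x = n + 1 := by omega
  by_contra! hlt
  have hxΛ : x ∈ Λ := h.mem_of_pos (by omega)
  have hp : p' x ≠ none := by
    intro hp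
    rcases h'.2 x hxΛ with ⟨-, h1⟩ | ⟨w, h1, -⟩
    · omega
    · simp [hp] at h1
  have h1 := h'.toCfg_lt hxΛ hp
  rw [lo_add_card_below, ← he] at h1
  have h2 := h.lo_le hxΛ
  have h3 : ((nbr x).filter fun z => l' x ≤ l' z + 1).card ≤ lo l x := by
    refine Finset.card_le_card fun z hz => ?_
    rw [Finset.mem_filter] at hz ⊢
    have := hn z
    exact ⟨hz.1, by omega⟩
  omega

lemma IsLeveled.level_eq_of_toCfg_eq (h : IsLeveled Λ l p) (h' : IsLeveled Λ l' p')
    (he : toCfg Λ l p = toCfg Λ l' p') : l = l' := by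
  have key : ∀ n z, l z ≤ n ↔ l' z ≤ n := by
    intro n
    induction n with
    | zero =>
      intro z
      by_cases hz : z ∈ Λ
      · have := h.pos hz
        have := h'.pos hz
        omega
      · simp [(h.1 z hz).1, (h'.1 z hz).1]
    | succ n ih =>
      exact fun z => ⟨h.level_le_of_toCfg_eq h' he ih,
        h'.level_le_of_toCfg_eq h he.symm fun z => (ih z).symm⟩
  exact funext fun z => le_antisymm ((key _ z).2 le_rfl) ((key _ z).1 le_rfl)

lemma IsLeveled.eq_of_toCfg_eq (h : IsLeveled Λ l p) (h' : IsLeveled Λ l' p')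
    (he : toCfg Λ l p = toCfg Λ l' p') : l = l' ∧ p = p' := by
  obtain rfl := h.level_eq_of_toCfg_eq h' he
  refine ⟨rfl, funext fun x => ?_⟩
  by_cases hx : x ∈ Λ
  · have hex := congrFun he x
    have hiff : p x = none ↔ p' x = none := by
      rw [← h.toCfg_eq_iff hx, ← h'.toCfg_eq_iff hx, hex]
    rcases h.code_cases hx with ⟨hp, -⟩ | ⟨w, hw, hp, hc⟩
    · rw [hp, hiff.1 hp]
    rcases h'.code_cases hx with ⟨hp', -⟩ | ⟨w', hw', hp', hc'⟩
    · rw [hp', hiff.2 hp']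
    · rw [hp, hp', rank_injOn _ hw hw' (by omega)]
  · rw [(h.1 x hx).2, (h'.1 x hx).2]

/-- The sites that survive `n` rounds of burning. -/
def unburnt (Λ : Finset (Zd d)) (ξ : Zd d → ℕ) : ℕ → Finset (Zd d)
  | 0 => Λ
  | n + 1 => (unburnt Λ ξ n).filter fun y =>
      ξ y < ((unburnt Λ ξ n).filter fun z => adj z y).card

lemma unburnt_succ_subset (Λ : Finset (Zd d)) (ξ : Zd d → ℕ) (n : ℕ) :
    unburnt Λ ξ (n + 1) ⊆ unburnt Λ ξ n :=
  Finset.filter_subset _ _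

lemma unburnt_antitone (Λ : Finset (Zd d)) (ξ : Zd d → ℕ) : Antitone (unburnt Λ ξ) :=
  antitone_nat_of_succ_le (unburnt_succ_subset Λ ξ)

lemma Allowed.card_unburnt {ξ : Zd d → ℕ} (h : Allowed Λ ξ) (n : ℕ) :
    (unburnt Λ ξ n).card ≤ Λ.card - n := by
  induction n with
  | zero => simp [unburnt]
  | succ n ih =>
    by_cases hne : (unburnt Λ ξ n).Nonempty
    · have hlt : (unburnt Λ ξ (n + 1)).card < (unburnt Λ ξ n).card := by
        refine Finset.card_lt_card ((unburnt_succ_subset Λ ξ n).ssubset_of_ne fun heq => ?_)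
        refine h _ (unburnt_antitone Λ ξ n.zero_le) hne fun y hy => ?_
        rw [← heq] at hy
        exact (Finset.mem_filter.1 hy).2
      omega
    · have := Finset.card_le_card (unburnt_succ_subset Λ ξ n)
      rw [Finset.not_nonempty_iff_eq_empty.1 hne, Finset.card_empty] at this
      omega

lemma Allowed.exists_burning_time {ξ : Zd d → ℕ} (h : Allowed Λ ξ) :
    ∃ l : Zd d → ℕ, ∀ x n, n < l x ↔ x ∈ unburnt Λ ξ n := by
  have hex : ∀ x, ∃ n, x ∉ unburnt Λ ξ n := fun x => by
    refine ⟨Λ.card, ?_⟩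
    have := h.card_unburnt Λ.card
    rw [Nat.sub_self, Nat.le_zero, Finset.card_eq_zero] at this
    simp [this]
  classical
  refine ⟨fun x => Nat.find (hex x), fun x n => ?_⟩
  rw [Nat.lt_find_iff]
  simp only [not_not]
  exact ⟨fun H => H n le_rfl, fun H m hm => unburnt_antitone Λ ξ hm H⟩

lemma Allowed.exists_isLeveled {ξ : Zd d → ℕ} (h : Allowed Λ ξ) (hle : ∀ x ∈ Λ, ξ x ≤ 2 * d)
    (hout : ∀ x ∉ Λ, ξ x = 0) : ∃ l p, IsLeveled Λ l p ∧ toCfg Λ l p = ξ := by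
  obtain ⟨l, hl⟩ := h.exists_burning_time
  have hpos : ∀ x, 0 < l x ↔ x ∈ Λ := fun x => hl x 0
  have hcount : ∀ x n, ((unburnt Λ ξ n).filter fun z => adj z x).card =
      ((nbr x).filter fun z => n < l z).card := fun x n => by
    congr 1
    ext z
    simp [hl, mem_nbr, and_comm]
  have hchoice : ∀ x, ∃ c : Option (Zd d), (x ∉ Λ → c = none) ∧ (x ∈ Λ →
      code l x c = ξ x ∧ ((c = none ∧ l x = 1) ∨ ∃ w, c = some w ∧ adj w x ∧ l x = l w + 1)) := by
    intro x
    by_cases hx : x ∈ Λ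
    · obtain ⟨n, hn⟩ : ∃ n, l x = n + 1 := Nat.exists_eq_succ_of_ne_zero ((hpos x).2 hx).ne'
      have hlo : lo l x ≤ ξ x := by
        have hnot : x ∉ unburnt Λ ξ (n + 1) := by rw [← hl]; omega
        have hmem : x ∈ unburnt Λ ξ n := by rw [← hl]; omega
        simp only [unburnt, Finset.mem_filter, hmem, true_and, not_lt, hcount] at hnot
        simpa only [lo, hn, Nat.succ_le_iff] using hnot
      have hup : (l x = 1 ∧ ξ x = 2 * d) ∨ ξ x < lo l x + (below l x).card := by
        rw [lo_add_card_below]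
        rcases n with _ | m
        · have : ((nbr x).filter fun z => l x ≤ l z + 1) = nbr x :=
            Finset.filter_true_of_mem fun z _ => by omega
          rw [this, card_nbr]
          have := hle x hx
          omega
        · right
          have hmem : x ∈ unburnt Λ ξ (m + 1) := by rw [← hl]; omega
          have := (Finset.mem_filter.1 hmem).2
          rw [hcount] at this
          convert this using 5
          omega
      rcases hup with ⟨h1, h2⟩ | hup
      · exact ⟨none, fun _ => rfl, fun _ => ⟨h2.symm, .inl ⟨rfl, h1⟩⟩⟩
      · obtain ⟨w, hw, hr⟩ := exists_rank_eq (S := below l x) (k := ξ x - lo l x) (by omega)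
        refine ⟨some w, fun h => absurd hx h, fun _ => ⟨?_, .inr ⟨w, rfl, mem_below.1 hw⟩⟩⟩
        simp only [code, hr]
        omega
    · exact ⟨none, fun _ => rfl, fun h => absurd h hx⟩
  choose p hp using hchoice
  refine ⟨l, p, ⟨fun x hx => ⟨?_, (hp x).1 hx⟩, fun x hx => ((hp x).2 hx).2⟩, funext fun x => ?_⟩
  · have := (hpos x).not.2 hx
    omega
  · by_cases hx : x ∈ Λ
    · simp [toCfg, hx, ((hp x).2 hx).1]
    · simp [toCfg, hx, hout x hx]

/-- The edge from `x` to its parent `c`. -/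
def edge (x : Zd d) : Option (Zd d) → EdgeG d
  | none => .diss x
  | some w => .ord s(x, w)

/-- The vertex of `G_Λ` represented by a parent. -/
def target (Λ : Finset (Zd d)) : Option (Zd d) → V d
  | none => Sum.inr ()
  | some w => proj Λ w

/-- The edge set of a parent function. -/
def toTree (Λ : Finset (Zd d)) (p : Zd d → Option (Zd d)) : Finset (EdgeG d) :=
  Λ.image fun x => edge x (p x)

lemma mem_toTree {e : EdgeG d} : e ∈ toTree Λ p ↔ ∃ x ∈ Λ, edge x (p x) = e := by
  simp [toTree]

lemma edge_injective (x : Zd d) : Function.Injective (edge x) := by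
  rintro (_ | a) (_ | b) h <;> simp [edge] at h ⊢
  rcases h with h | ⟨rfl, rfl⟩
  exacts [h, rfl]

lemma proj_of_mem {x : Zd d} (hx : x ∈ Λ) : proj Λ x = Sum.inl x := if_pos hx

lemma proj_of_notMem {x : Zd d} (hx : x ∉ Λ) : proj Λ x = Sum.inr () := if_neg hx

lemma proj_eq_inl {x y : Zd d} : proj Λ x = Sum.inl y ↔ x = y ∧ y ∈ Λ := by
  unfold proj
  split_ifs with h
  · simp only [Sum.inl.injEq]
    exact ⟨fun h' => ⟨h', h' ▸ h⟩, fun h' => h'.1⟩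
  · simp only [false_iff]
    rintro ⟨rfl, h'⟩
    exact h h'

lemma joins_edge {x : Zd d} (hx : x ∈ Λ) {c : Option (Zd d)} {u v : V d} :
    joins Λ (edge x c) u v ↔
      (u = Sum.inl x ∧ v = target Λ c) ∨ (u = target Λ c ∧ v = Sum.inl x) := by
  cases c with
  | none => rfl
  | some w =>
    simp only [edge, joins, target]
    constructor
    · rintro ⟨a, b, hab, h⟩
      rw [Sym2.eq_iff] at hab
      rcases hab with ⟨rfl, rfl⟩ | ⟨rfl, rfl⟩
      · rwa [proj_of_mem hx] at h
      · rw [proj_of_mem hx] at h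
        exact h.symm
    · intro h
      exact ⟨x, w, rfl, by rwa [proj_of_mem hx]⟩

lemma joins_comm {e : EdgeG d} {u v : V d} : joins Λ e u v ↔ joins Λ e v u := by
  cases e with
  | ord e =>
    simp only [joins]
    constructor <;> rintro ⟨x, y, he, h⟩ <;> exact ⟨x, y, he, by tauto⟩
  | diss x =>
    simp only [joins]
    tauto

lemma connIn.symm {t : Set (EdgeG d)} {u v : V d} (h : connIn Λ t u v) : connIn Λ t v u := by
  have : Std.Symm fun a b => ∃ e ∈ t, joins Λ e a b :=
    ⟨fun _ _ ⟨e, he, hj⟩ => ⟨e, he, joins_comm.1 hj⟩⟩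
  exact Relation.ReflTransGen.stdSymm.symm _ _ h

lemma connIn.mono {s t : Set (EdgeG d)} (hst : s ⊆ t) {u v : V d} (h : connIn Λ s u v) :
    connIn Λ t u v :=
  Relation.ReflTransGen.mono (fun _ _ ⟨e, he, hj⟩ => ⟨e, hst he, hj⟩) _ _ h

lemma eq_inl_or_inr_of_joins {e : EdgeG d} (he : validEdge Λ e) {u v : V d}
    (h : joins Λ e u v) : (∃ x ∈ Λ, u = Sum.inl x) ∨ u = Sum.inr () := by
  have hproj : ∀ x, (∃ y ∈ Λ, proj Λ x = Sum.inl y) ∨ proj Λ x = Sum.inr () := fun x => by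
    by_cases hx : x ∈ Λ
    · exact .inl ⟨x, hx, proj_of_mem hx⟩
    · exact .inr (proj_of_notMem hx)
  cases e with
  | ord e =>
    obtain ⟨x, y, -, ⟨rfl, -⟩ | ⟨rfl, -⟩⟩ := h
    · exact hproj x
    · exact hproj y
  | diss x =>
    obtain ⟨rfl, -⟩ | ⟨rfl, -⟩ := h
    · exact .inl ⟨x, he, rfl⟩
    · exact .inr rfl

lemma exists_edge_of_joins {e : EdgeG d} (he : validEdge Λ e) {x : Zd d} {u : V d}
    (h : joins Λ e (Sum.inl x) u) :
    ∃ c, edge x c = e ∧ target Λ c = u ∧ ∀ w, c = some w → adj w x := by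
  cases e with
  | ord e =>
    obtain ⟨a, b, rfl, hab, -⟩ := he
    obtain ⟨a', b', hs, h⟩ := h
    have hadj : adj a' b' := by
      rw [Sym2.eq_iff] at hs
      rcases hs with ⟨rfl, rfl⟩ | ⟨rfl, rfl⟩
      · exact hab
      · exact adj_comm.1 hab
    rw [hs]
    rcases h with ⟨h1, rfl⟩ | ⟨h1, rfl⟩
    · obtain ⟨rfl, -⟩ := proj_eq_inl.1 h1.symm
      exact ⟨some b', rfl, rfl, by rintro w ⟨⟩; exact adj_comm.1 hadj⟩
    · obtain ⟨rfl, -⟩ := proj_eq_inl.1 h1.symm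
      exact ⟨some a', congrArg EdgeG.ord Sym2.eq_swap, rfl, by rintro w ⟨⟩; exact hadj⟩
  | diss y =>
    obtain ⟨h1, rfl⟩ | ⟨h1, -⟩ := h
    · obtain rfl := Sum.inl_injective h1
      exact ⟨none, rfl, rfl, by simp⟩
    · simp at h1

/-- The level as a function on the vertices of `G_Λ`. -/
def vlevel (l : Zd d → ℕ) : V d → ℕ := Sum.elim l fun _ => 0

lemma IsLeveled.vlevel_target (h : IsLeveled Λ l p) {x : Zd d} (hx : x ∈ Λ) :
    l x = vlevel l (target Λ (p x)) + 1 := by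
  rcases h.2 x hx with ⟨hp, hl⟩ | ⟨w, hp, -, hl⟩
  · simp [hp, hl, target, vlevel]
  · by_cases hw : w ∈ Λ
    · simp [hp, hl, target, proj_of_mem hw, vlevel]
    · simp [hp, hl, target, proj_of_notMem hw, vlevel, (h.1 w hw).1]

lemma target_eq (Λ : Finset (Zd d)) (c : Option (Zd d)) :
    (∃ w ∈ Λ, c = some w ∧ target Λ c = Sum.inl w) ∨ target Λ c = Sum.inr () := by
  rcases c with _ | w
  · exact .inr rfl
  · by_cases hw : w ∈ Λ
    · exact .inl ⟨w, hw, rfl, proj_of_mem hw⟩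
    · exact .inr (proj_of_notMem hw)

lemma IsLeveled.connIn_root (h : IsLeveled Λ l p) {x : Zd d} (hx : x ∈ Λ) :
    connIn Λ (toTree Λ p) (Sum.inl x) (Sum.inr ()) := by
  induction hn : l x using Nat.strong_induction_on generalizing x with
  | _ n ih =>
    have hstep : ∃ e ∈ (toTree Λ p : Set (EdgeG d)), joins Λ e (Sum.inl x) (target Λ (p x)) :=
      ⟨edge x (p x), mem_toTree.2 ⟨x, hx, rfl⟩, (joins_edge hx).2 (.inl ⟨rfl, rfl⟩)⟩
    have hl := h.vlevel_target hx
    refine Relation.ReflTransGen.head hstep ?_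
    rcases target_eq Λ (p x) with ⟨w, hw, -, ht⟩ | ht
    · rw [ht] at hl ⊢
      exact ih (l w) (by simp only [vlevel, Sum.elim_inl] at hl; omega) hw rfl
    · rw [ht]

lemma IsLeveled.not_connIn (h : IsLeveled Λ l p) {x : Zd d} (hx : x ∈ Λ) :
    ¬ connIn Λ ((toTree Λ p : Set (EdgeG d)) \ {edge x (p x)}) (Sum.inl x)
      (target Λ (p x)) := by
  intro hconn
  let r : V d → V d → Prop := fun u v => ∃ y ∈ Λ, u = Sum.inl y ∧ v = target Λ (p y)
  have hdesc : ∀ u v, Relation.ReflTransGen r u v → vlevel l v ≤ vlevel l u := by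
    intro u v huv
    induction huv with
    | refl => exact le_rfl
    | tail _ hs ih =>
      obtain ⟨y, hy, rfl, rfl⟩ := hs
      have := h.vlevel_target hy
      simp only [vlevel, Sum.elim_inl] at ih this ⊢
      omega
  have hclosed : ∀ v, connIn Λ ((toTree Λ p : Set (EdgeG d)) \ {edge x (p x)}) (Sum.inl x) v →
      Relation.ReflTransGen r v (Sum.inl x) := by
    intro v hv
    induction hv with
    | refl => exact .refl
    | tail _ hs ih =>
      obtain ⟨e, ⟨he, hne⟩, hj⟩ := hs
      obtain ⟨y, hy, rfl⟩ := mem_toTree.1 he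
      rcases (joins_edge hy).1 hj with ⟨rfl, rfl⟩ | ⟨rfl, rfl⟩
      · rcases Relation.ReflTransGen.cases_head ih with heq | ⟨c, ⟨z, _, hz, rfl⟩, hc⟩
        · obtain rfl := Sum.inl_injective heq
          exact absurd rfl hne
        · obtain rfl := Sum.inl_injective hz
          exact hc
      · exact .head ⟨y, hy, rfl, rfl⟩ ih
  have h1 := hdesc _ _ (hclosed _ hconn)
  have h2 := h.vlevel_target hx
  simp only [vlevel, Sum.elim_inl] at h1 h2
  omega

lemma IsLeveled.isSpanningTree (h : IsLeveled Λ l p) : IsSpanningTree Λ (toTree Λ p) := by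
  refine ⟨fun e he => ?_, fun x hx => h.connIn_root hx, fun e he u v hj hc => ?_⟩
  · obtain ⟨x, hx, rfl⟩ := mem_toTree.1 he
    rcases h.2 x hx with ⟨hp, -⟩ | ⟨w, hp, ha, -⟩
    · simpa [hp, edge, validEdge] using hx
    · rw [hp]
      exact ⟨x, w, rfl, adj_comm.1 ha, .inl hx⟩
  · obtain ⟨x, hx, rfl⟩ := mem_toTree.1 he
    rcases (joins_edge hx).1 hj with ⟨rfl, rfl⟩ | ⟨rfl, rfl⟩
    · exact h.not_connIn hx hc
    · exact h.not_connIn hx hc.symm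

lemma IsLeveled.diss_mem_toTree (h : IsLeveled Λ l p) {x : Zd d} :
    EdgeG.diss x ∈ toTree Λ p ↔ x ∈ Λ ∧ toCfg Λ l p x = 2 * d := by
  rw [mem_toTree]
  constructor
  · rintro ⟨y, hy, he⟩
    rcases hp : p y with _ | w
    · rw [hp] at he
      obtain rfl : y = x := by simpa [edge] using he
      exact ⟨hy, (h.toCfg_eq_iff hy).2 hp⟩
    · simp [hp, edge] at he
  · rintro ⟨hx, hc⟩
    exact ⟨x, hx, by rw [(h.toCfg_eq_iff hx).1 hc]; rfl⟩

lemma IsLeveled.parent_eq_of_toTree_eq (h : IsLeveled Λ l p) (h' : IsLeveled Λ l' p')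
    (he : toTree Λ p = toTree Λ p') : p = p' := by
  have key : ∀ n x, x ∈ Λ → l x = n → p x = p' x := by
    intro n
    induction n using Nat.strong_induction_on with
    | _ n ih =>
      intro x hx hn
      have hmem : edge x (p x) ∈ toTree Λ p' := he ▸ mem_toTree.2 ⟨x, hx, rfl⟩
      obtain ⟨y, hy, hey⟩ := mem_toTree.1 hmem
      by_cases hxy : y = x
      · subst hxy
        exact (edge_injective y hey).symm
      exfalso
      rcases h.2 x hx with ⟨hp, -⟩ | ⟨w, hp, -, hl⟩
      · rcases hp' : p' y with _ | w' <;> simp_all [edge]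
      · rcases hp' : p' y with _ | w'
        · simp [hp, hp', edge] at hey
        · rw [hp, hp'] at hey
          simp only [edge, EdgeG.ord.injEq, Sym2.eq_iff] at hey
          rcases hey with ⟨h1, -⟩ | ⟨rfl, rfl⟩
          · exact hxy h1
          · have hpy := ih (l y) (by omega) y hy rfl
            rcases h.2 y hy with ⟨hq, -⟩ | ⟨z, hq, -, hl'⟩
            · simp [hpy, hp'] at hq
            · rw [hpy, hp'] at hq
              obtain rfl := Option.some_injective _ hq
              omega
  funext x
  by_cases hx : x ∈ Λ
  · exact key _ x hx rfl
  · rw [(h.1 x hx).2, (h'.1 x hx).2]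

lemma IsLeveled.level_eq (h : IsLeveled Λ l p) (h' : IsLeveled Λ l' p) : l = l' := by
  have key : ∀ n x, l x = n → l x = l' x := by
    intro n
    induction n using Nat.strong_induction_on with
    | _ n ih =>
      intro x hn
      by_cases hx : x ∈ Λ
      · rcases h.2 x hx with ⟨hp, hl⟩ | ⟨w, hp, -, hl⟩ <;>
          rcases h'.2 x hx with ⟨hp', hl'⟩ | ⟨w', hp', -, hl'⟩
        · rw [hl, hl']
        · simp [hp] at hp'
        · simp [hp] at hp'
        · rw [hp] at hp'
          obtain rfl := Option.some_injective _ hp'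
          rw [hl, hl', ih (l w) (by omega) w rfl]
      · rw [(h.1 x hx).1, (h'.1 x hx).1]
  exact funext fun x => key _ x rfl

lemma exists_dist {α : Type*} (r : α → α → Prop) (o : α) :
    ∃ f : α → ℕ, f o = 0 ∧ ∀ v, v ≠ o → Relation.ReflTransGen r v o →
      ∃ u, r v u ∧ f v = f u + 1 := by
  let P : ℕ → α → Prop := fun n => Nat.rec (fun v => v = o) (fun _ Q v => ∃ u, r v u ∧ Q u) n
  have hP : ∀ v, Relation.ReflTransGen r v o → ∃ n, P n v := by
    intro v hv
    induction hv using Relation.ReflTransGen.head_induction_on with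
    | refl => exact ⟨0, rfl⟩
    | head hs _ ih =>
      obtain ⟨n, hn⟩ := ih
      exact ⟨n + 1, _, hs, hn⟩
  refine ⟨fun v => sInf {n | P n v}, Nat.sInf_eq_zero.2 (.inl rfl), fun v hv hr => ?_⟩
  have hmem : P (sInf {n | P n v}) v := Nat.sInf_mem (s := {n | P n v}) (hP v hr)
  rcases hn : sInf {n | P n v} with _ | n
  · rw [hn] at hmem
    exact absurd hmem hv
  · rw [hn] at hmem
    obtain ⟨u, hu, hPu⟩ := hmem
    refine ⟨u, hu, ?_⟩
    have h1 : sInf {n | P n u} ≤ n := Nat.sInf_le hPu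
    have h2 : P (sInf {n | P n u}) u := Nat.sInf_mem (s := {n | P n u}) ⟨n, hPu⟩
    have h3 : sInf {n | P n v} ≤ sInf {n | P n u} + 1 := Nat.sInf_le ⟨u, hu, h2⟩
    simp only [hn]
    omega

lemma eq_of_subset_of_connected {s t : Finset (EdgeG d)} (ht : IsSpanningTree Λ t) (hst : s ⊆ t)
    (hs : ∀ x ∈ Λ, connIn Λ s (Sum.inl x) (Sum.inr ())) : s = t := by
  refine hst.antisymm fun e he => ?_
  by_contra hes
  obtain ⟨u, v, hj⟩ : ∃ u v, joins Λ e u v := by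
    cases e with
    | ord e =>
      induction e using Sym2.ind with
      | _ x y => exact ⟨proj Λ x, proj Λ y, x, y, rfl, .inl ⟨rfl, rfl⟩⟩
    | diss x => exact ⟨_, _, .inl ⟨rfl, rfl⟩⟩
  have hroot : ∀ a b, joins Λ e a b → connIn Λ s a (Sum.inr ()) := by
    intro a b hab
    rcases eq_inl_or_inr_of_joins (ht.1 e he) hab with ⟨x, hx, rfl⟩ | rfl
    · exact hs x hx
    · exact .refl
  have hsub : (s : Set (EdgeG d)) ⊆ (t : Set (EdgeG d)) \ {e} := fun f hf =>
    ⟨hst hf, fun hfe => hes (hfe ▸ hf)⟩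
  have huv : connIn Λ s u v := (hroot u v hj).trans (connIn.symm (hroot v u (joins_comm.1 hj)))
  exact ht.2.2 e he u v hj (connIn.mono hsub huv)

lemma IsSpanningTree.exists_isLeveled {t : Finset (EdgeG d)} (ht : IsSpanningTree Λ t) :
    ∃ l p, IsLeveled Λ l p ∧ toTree Λ p = t := by
  obtain ⟨f, hf0, hf⟩ := exists_dist
    (fun a b : V d => ∃ e ∈ (t : Set (EdgeG d)), joins Λ e a b) (Sum.inr ())
  have hchoice : ∀ x, ∃ c : Option (Zd d), (x ∉ Λ → c = none) ∧ (x ∈ Λ → edge x c ∈ t ∧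
      f (Sum.inl x) = f (target Λ c) + 1 ∧ ∀ w, c = some w → adj w x) := by
    intro x
    by_cases hx : x ∈ Λ
    · obtain ⟨u, ⟨e, he, hj⟩, hu⟩ := hf (Sum.inl x) (by simp) (ht.2.1 x hx)
      obtain ⟨c, rfl, rfl, hc⟩ := exists_edge_of_joins (ht.1 e he) hj
      exact ⟨c, fun h => absurd hx h, fun _ => ⟨he, hu, hc⟩⟩
    · exact ⟨none, fun _ => rfl, fun h => absurd h hx⟩
  choose p hp using hchoice
  have hlev : IsLeveled Λ (fun x => f (proj Λ x)) p := by
    refine ⟨fun x hx => ⟨?_, (hp x).1 hx⟩, fun x hx => ?_⟩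
    · simp only [proj_of_notMem hx, hf0]
    · obtain ⟨-, h2, h3⟩ := (hp x).2 hx
      rcases hc : p x with _ | w
      · left
        rw [hc] at h2
        simpa [proj_of_mem hx, target, hf0] using h2
      · right
        rw [hc] at h2
        exact ⟨w, rfl, h3 w hc, by simpa only [proj_of_mem hx, target] using h2⟩
  refine ⟨_, p, hlev, eq_of_subset_of_connected ht (fun e he => ?_) fun x hx =>
    hlev.connIn_root hx⟩
  obtain ⟨x, hx, rfl⟩ := mem_toTree.1 he
  exact ((hp x).2 hx).1

/-- Majumdar–Dhar bijection: there is a bijection `σ` from allowed configurations onto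
spanning trees of `G_Λ` such that the dissipative edges of `σ ξ` are exactly
`{diss x : ξ x = 2d}`; in particular `σ` restricts to a bijection between allowed
configurations in `{0,…,2d−1}^Λ` and spanning trees with no dissipative edge. -/
theorem majumdar_dhar_bijection (d : ℕ) (hd : 1 ≤ d) (Λ : Finset (Zd d)) :
    ∃ σ : AllowedCfg d Λ → SpTree d Λ, Function.Bijective σ ∧
      (∀ ξ : AllowedCfg d Λ, ∀ x : Zd d,
        EdgeG.diss x ∈ (σ ξ).1 ↔ (x ∈ Λ ∧ ξ.1 x = 2*d)) ∧
      (∀ ξ : AllowedCfg d Λ,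
        ((∀ x ∈ Λ, ξ.1 x < 2*d) ↔ ∀ x : Zd d, EdgeG.diss x ∉ (σ ξ).1)) := by
  let M := {q : (Zd d → ℕ) × (Zd d → Option (Zd d)) // IsLeveled Λ q.1 q.2}
  let toC : M → AllowedCfg d Λ := fun q =>
    ⟨toCfg Λ q.1.1 q.1.2, fun x hx => q.2.toCfg_le hx, fun x hx => if_neg hx, q.2.allowed⟩
  let toT : M → SpTree d Λ := fun q => ⟨toTree Λ q.1.2, q.2.isSpanningTree⟩
  have hC : Function.Bijective toC := by
    refine ⟨fun q q' h => ?_, fun ξ => ?_⟩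
    · obtain ⟨h1, h2⟩ := q.2.eq_of_toCfg_eq q'.2 (congrArg Subtype.val h)
      exact Subtype.ext (Prod.ext h1 h2)
    · obtain ⟨l, p, h, he⟩ := ξ.2.2.2.exists_isLeveled ξ.2.1 ξ.2.2.1
      exact ⟨⟨(l, p), h⟩, Subtype.ext he⟩
  have hT : Function.Bijective toT := by
    refine ⟨fun ⟨⟨l, p⟩, h⟩ ⟨⟨l', p'⟩, h'⟩ he => ?_, fun t => ?_⟩
    · obtain rfl : p = p' := h.parent_eq_of_toTree_eq h' (congrArg Subtype.val he)
      obtain rfl : l = l' := h.level_eq h'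
      rfl
    · obtain ⟨l, p, h, he⟩ := t.2.exists_isLeveled
      exact ⟨⟨(l, p), h⟩, Subtype.ext he⟩
  let e := Equiv.ofBijective toC hC
  have hdiss : ∀ ξ : AllowedCfg d Λ, ∀ x : Zd d,
      EdgeG.diss x ∈ (toT (e.symm ξ)).1 ↔ (x ∈ Λ ∧ ξ.1 x = 2 * d) := by
    intro ξ x
    obtain ⟨q, rfl⟩ := e.surjective ξ
    rw [e.symm_apply_apply]
    exact q.2.diss_mem_toTree
  refine ⟨toT ∘ e.symm, hT.comp e.symm.bijective, hdiss, fun ξ => ?_⟩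
  simp only [Function.comp_apply, hdiss, not_and]
  exact forall₂_congr fun x hx => (ξ.2.1 x hx).lt_iff_ne

end Sandpile1
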